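/- Any two hexagonal typical 6-configurations can be joined by a Q-deformation; i.e., the hexagonal typical 6-configurations form a single Q-deformation class. -/

import Mathlib

open scoped LinearAlgebra.Projectivization
open Projectivization

noncomputable section

/-- The real projective plane: the projectivization of `ℝ³`. -/
abbrev RP2 := ℙ ℝ (Fin 3 → ℝ)

/-- The quotient topology on the real projective plane. -/
instance : TopologicalSpace RP2 :=
  inferInstanceAs (TopologicalSpace (Quotient (projectivizationSetoid ℝ (Fin 3 → ℝ))))

/-- Three points of `ℙ²(ℝ)` are collinear if they admit linearly dependent representatives. -/
def Collin (a b c : RP2) : Prop :=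
  ¬ LinearIndependent ℝ ![a.rep, b.rep, c.rep]

/-- The conic (zero set in `ℙ²(ℝ)`) associated to a quadratic form on `ℝ³`. -/
def ConicSet (q : QuadraticForm ℝ (Fin 3 → ℝ)) : Set RP2 := {p : RP2 | q p.rep = 0}

/-- A set of points is coconic if some conic contains all of them. -/
def Coconic (s : Set RP2) : Prop :=
  ∃ q : QuadraticForm ℝ (Fin 3 → ℝ), q ≠ 0 ∧ ∀ p ∈ s, q p.rep = 0

/-- A labeled `n`-configuration is simple if it is injective and has no collinear triple. -/
def SimpleCfg {n : ℕ} (f : Fin n → RP2) : Prop :=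
  Function.Injective f ∧
    ∀ i j k : Fin n, i ≠ j → i ≠ k → j ≠ k → ¬ Collin (f i) (f j) (f k)

/-- A labeled `n`-configuration is typical if it is simple and no six of its points are coconic. -/
def TypicalCfg {n : ℕ} (f : Fin n → RP2) : Prop :=
  SimpleCfg f ∧ ∀ g : Fin 6 → Fin n, Function.Injective g → ¬ Coconic (Set.range (f ∘ g))

/-- A projective line: the set of points whose representatives lie in a 2-dimensional
subspace of `ℝ³`. -/
def IsProjLine (L : Set RP2) : Prop :=
  ∃ W : Submodule ℝ (Fin 3 → ℝ), Module.finrank ℝ W = 2 ∧ L = {p : RP2 | p.rep ∈ W}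

/-- `p` lies inside the conic of `q` if every projective line through `p` meets the conic. -/
def InsideConic (q : QuadraticForm ℝ (Fin 3 → ℝ)) (p : RP2) : Prop :=
  ∀ L : Set RP2, IsProjLine L → p ∈ L → (L ∩ ConicSet q).Nonempty

/-- `p` lies outside the conic of `q` if some projective line through `p` misses the conic. -/
def OutsideConic (q : QuadraticForm ℝ (Fin 3 → ℝ)) (p : RP2) : Prop :=
  ∃ L : Set RP2, IsProjLine L ∧ p ∈ L ∧ L ∩ ConicSet q = ∅

/-- A point `f i` of a configuration is dominant if it lies outside every conic passing
through all the other points of the configuration. -/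
def Dominant {n : ℕ} (f : Fin n → RP2) (i : Fin n) : Prop :=
  ∀ q : QuadraticForm ℝ (Fin 3 → ℝ), q ≠ 0 → (∀ j, j ≠ i → q ((f j).rep) = 0) →
    OutsideConic q (f i)

/-- A point `f i` of a configuration is subdominant if it lies inside every conic passing
through all the other points of the configuration. -/
def Subdominant {n : ℕ} (f : Fin n → RP2) (i : Fin n) : Prop :=
  ∀ q : QuadraticForm ℝ (Fin 3 → ℝ), q ≠ 0 → (∀ j, j ≠ i → q ((f j).rep) = 0) →
    InsideConic q (f i)

/-- The affine chart determined by a nonzero linear functional `φ` (with `L∞ = {φ = 0}`):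
a point off `L∞` is sent to its representative rescaled to lie on the affine plane `φ = 1`. -/
def chart (φ : (Fin 3 → ℝ) →ₗ[ℝ] ℝ) (p : RP2) : Fin 3 → ℝ := (φ p.rep)⁻¹ • p.rep

/-- Convex position with respect to the affine chart of `φ`: the line `{φ = 0}` misses the
configuration, and in the chart every point lies outside the convex hull of the others. -/
def ConvexPosWith {n : ℕ} (φ : (Fin 3 → ℝ) →ₗ[ℝ] ℝ) (f : Fin n → RP2) : Prop :=
  φ ≠ 0 ∧ (∀ i, φ (f i).rep ≠ 0) ∧
    ∀ i, chart φ (f i) ∉ convexHull ℝ (chart φ '' (f '' {j | j ≠ i}))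

/-- A configuration is in convex position if it is so in some affine chart. -/
def ConvexPos {n : ℕ} (f : Fin n → RP2) : Prop := ∃ φ, ConvexPosWith φ f

/-- The labeling of a configuration is consecutive for the convex position in the chart of `φ`:
each pair `f i`, `f (i+1)` (cyclically) spans an edge of the convex polygon, i.e. is cut out by
an affine functional which is strictly larger on both of them than on all the other points. -/
def ConsecWith {n : ℕ} [NeZero n] (φ : (Fin 3 → ℝ) →ₗ[ℝ] ℝ) (f : Fin n → RP2) : Prop :=
  ConvexPosWith φ f ∧
    ∀ i : Fin n, ∃ ψ : (Fin 3 → ℝ) →ₗ[ℝ] ℝ,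
      ψ (chart φ (f i)) = ψ (chart φ (f (i + 1))) ∧
      ∀ j : Fin n, j ≠ i → j ≠ i + 1 → ψ (chart φ (f j)) < ψ (chart φ (f i))

/-- A configuration is in convex position with consecutive cyclic labeling. -/
def ConsecConvexPos {n : ℕ} [NeZero n] (f : Fin n → RP2) : Prop := ∃ φ, ConsecWith φ f

/-- A Q-deformation (an `n`-tuple of continuous paths through typical configurations). -/
def QDeformFam (n : ℕ) (γ : Fin n → unitInterval → RP2) : Prop :=
  (∀ i, Continuous (γ i)) ∧ ∀ t : unitInterval, TypicalCfg (fun i => γ i t)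

end
noncomputable section

section GeneralLinear

open Matrix

/-- The set of invertible real `3 × 3` matrices is covered by the path components of `1` and `-1`. -/
theorem joinedIn_one_or_neg_one_of_det_ne_zero (M : Matrix (Fin 3) (Fin 3) ℝ) (hM : M.det ≠ 0) :
    JoinedIn {N : Matrix (Fin 3) (Fin 3) ℝ | N.det ≠ 0} M 1 ∨
      JoinedIn {N : Matrix (Fin 3) (Fin 3) ℝ | N.det ≠ 0} M (-1) := by
  set G : Set (Matrix (Fin 3) (Fin 3) ℝ) := {N | N.det ≠ 0} with hG
  have mul_joined {A B A' B' : Matrix (Fin 3) (Fin 3) ℝ} (hA : JoinedIn G A A')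
      (hB : JoinedIn G B B') : JoinedIn G (A * B) (A' * B') := by
    refine (JoinedIn.mul hA hB).mono ?_
    rintro _ ⟨X, hX, Y, hY, rfl⟩
    simp only [hG, Set.mem_ofPred_eq, det_mul] at hX hY ⊢
    exact mul_ne_zero hX hY
  have mul_closed {A B : Matrix (Fin 3) (Fin 3) ℝ} (hA : JoinedIn G A 1 ∨ JoinedIn G A (-1))
      (hB : JoinedIn G B 1 ∨ JoinedIn G B (-1)) :
      JoinedIn G (A * B) 1 ∨ JoinedIn G (A * B) (-1) := by
    rcases hA with hA | hA <;> rcases hB with hB | hB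
    · exact Or.inl (by simpa using mul_joined hA hB)
    · exact Or.inr (by simpa using mul_joined hA hB)
    · exact Or.inr (by simpa using mul_joined hA hB)
    · exact Or.inl (by simpa using mul_joined hA hB)
  have pos {a : ℝ} (ha : 0 < a) {t : ℝ} (ht : t ∈ unitInterval) : 0 < (1 - t) * a + t := by
    rcases ht.1.eq_or_lt with rfl | h0
    · simpa using ha
    · have := mul_nonneg (sub_nonneg.2 ht.2) ha.le
      linarith
  have neg {a : ℝ} (ha : a < 0) {t : ℝ} (ht : t ∈ unitInterval) : (1 - t) * a - t < 0 := by
    have := pos (neg_pos.2 ha) ht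
    linarith
  have rot (t : ℝ) : Real.cos (Real.pi * t) ^ 2 + Real.sin (Real.pi * t) ^ 2 = 1 :=
    Real.cos_sq_add_sin_sq _
  have diag₀ {a : ℝ} (ha : a ≠ 0) : JoinedIn G !![a, 0, 0; 0, 1, 0; 0, 0, 1] 1 ∨
      JoinedIn G !![a, 0, 0; 0, 1, 0; 0, 0, 1] (-1) := by
    rcases ha.lt_or_gt with ha | ha
    · refine Or.inr (JoinedIn.ofLine (f := fun t => !![(1 - t) * a - t, 0, 0;
        0, Real.cos (Real.pi * t), -Real.sin (Real.pi * t);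
        0, Real.sin (Real.pi * t), Real.cos (Real.pi * t)]) ?_ ?_ ?_ ?_)
      · refine Continuous.continuousOn (continuous_matrix fun i j => ?_)
        fin_cases i <;> fin_cases j <;> simp <;> fun_prop
      · simp
      · ext i j
        fin_cases i <;> fin_cases j <;> simp
      · rintro _ ⟨t, ht, rfl⟩
        have hdet : det !![(1 - t) * a - t, 0, 0;
            0, Real.cos (Real.pi * t), -Real.sin (Real.pi * t);
            0, Real.sin (Real.pi * t), Real.cos (Real.pi * t)] = (1 - t) * a - t := by
          simp [det_fin_three]
          linear_combination ((1 - t) * a - t) * rot t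
        exact hdet.trans_ne (neg ha ht).ne
    · refine Or.inl (JoinedIn.ofLine (f := fun t => !![(1 - t) * a + t, 0, 0; 0, 1, 0; 0, 0, 1])
        ?_ ?_ ?_ ?_)
      · refine Continuous.continuousOn (continuous_matrix fun i j => ?_)
        fin_cases i <;> fin_cases j <;> simp <;> fun_prop
      · simp
      · ext i j
        fin_cases i <;> fin_cases j <;> simp
      · rintro _ ⟨t, ht, rfl⟩
        simpa [hG, det_fin_three] using (pos ha ht).ne'
  have conj {A B C : Matrix (Fin 3) (Fin 3) ℝ} (hBC : B * C = 1)
      (hA : JoinedIn G A 1 ∨ JoinedIn G A (-1)) :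
      JoinedIn G (B * A * C) 1 ∨ JoinedIn G (B * A * C) (-1) := by
    have hdet : B.det * C.det = 1 := by rw [← det_mul, hBC, det_one]
    have hB : B ∈ G := left_ne_zero_of_mul_eq_one hdet
    have hC : C ∈ G := right_ne_zero_of_mul_eq_one hdet
    refine hA.imp (fun h => ?_) (fun h => ?_)
    · simpa [hBC] using mul_joined (mul_joined (JoinedIn.refl hB) h) (JoinedIn.refl hC)
    · simpa [hBC] using mul_joined (mul_joined (JoinedIn.refl hB) h) (JoinedIn.refl hC)
  refine diagonal_transvection_induction_of_det_ne_zero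
    (fun A => JoinedIn G A 1 ∨ JoinedIn G A (-1)) M hM ?_ ?_ fun A B _ _ => mul_closed
  · intro d hd
    rw [det_diagonal, Fin.prod_univ_three] at hd
    have h0 : d 0 ≠ 0 := fun h => hd (by simp [h])
    have h1 : d 1 ≠ 0 := fun h => hd (by simp [h])
    have h2 : d 2 ≠ 0 := fun h => hd (by simp [h])
    have diag₁ := conj (B := !![0, 0, 1; 1, 0, 0; 0, 1, 0]) (C := !![0, 1, 0; 0, 0, 1; 1, 0, 0])
      (by ext i j; fin_cases i <;> fin_cases j <;> simp) (diag₀ h1)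
    have diag₂ := conj (B := !![0, 1, 0; 0, 0, 1; 1, 0, 0]) (C := !![0, 0, 1; 1, 0, 0; 0, 1, 0])
      (by ext i j; fin_cases i <;> fin_cases j <;> simp) (diag₀ h2)
    have key := mul_closed (mul_closed (diag₀ h0) diag₁) diag₂
    convert key using 2 <;>
    · ext i j
      fin_cases i <;> fin_cases j <;> simp
  · intro t
    refine Or.inl (JoinedIn.ofLine (f := fun s => transvection t.i t.j ((1 - s) * t.c)) ?_ ?_ ?_ ?_)
    · refine Continuous.continuousOn (continuous_matrix fun i j => ?_)
      simp only [transvection, Matrix.add_apply, single_apply]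
      split_ifs <;> fun_prop
    · simp [TransvectionStruct.toMatrix]
    · simp
    · rintro _ ⟨s, -, rfl⟩
      simp [hG, det_transvection_of_ne _ _ t.hij]

end GeneralLinear

section Brackets

open Matrix

/-- The determinant of three vectors of `ℝ³`. -/
def bracket (u v w : Fin 3 → ℝ) : ℝ := (Matrix.of ![u, v, w]).det

theorem bracket_eq (u v w : Fin 3 → ℝ) :
    bracket u v w = u 0 * (v 1 * w 2 - v 2 * w 1) - u 1 * (v 0 * w 2 - v 2 * w 0) +
      u 2 * (v 0 * w 1 - v 1 * w 0) := by
  simp [bracket, det_fin_three]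
  ring

theorem bracket_swap_left (u v w : Fin 3 → ℝ) : bracket v u w = -bracket u v w := by
  simp only [bracket_eq]; ring

theorem bracket_swap_right (u v w : Fin 3 → ℝ) : bracket u w v = -bracket u v w := by
  simp only [bracket_eq]; ring

theorem bracket_rotate (u v w : Fin 3 → ℝ) : bracket v w u = bracket u v w := by
  simp only [bracket_eq]; ring

theorem bracket_smul (a b c : ℝ) (u v w : Fin 3 → ℝ) :
    bracket (a • u) (b • v) (c • w) = a * b * c * bracket u v w := by
  simp only [bracket_eq, Pi.smul_apply, smul_eq_mul]; ring

theorem bracket_mulVec (g : Matrix (Fin 3) (Fin 3) ℝ) (u v w : Fin 3 → ℝ) :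
    bracket (g *ᵥ u) (g *ᵥ v) (g *ᵥ w) = g.det * bracket u v w := by
  simp only [bracket_eq, det_fin_three, mulVec, dotProduct, Fin.sum_univ_three]; ring

theorem linearIndependent_iff_bracket_ne_zero (u v w : Fin 3 → ℝ) :
    LinearIndependent ℝ ![u, v, w] ↔ bracket u v w ≠ 0 := by
  rw [bracket, ← isUnit_iff_ne_zero, ← isUnit_iff_isUnit_det,
    ← linearIndependent_rows_iff_isUnit]
  rfl

/-- Cramer's rule in `ℝ³`. -/
theorem bracket_smul_eq (u v w x : Fin 3 → ℝ) :
    bracket u v w • x = bracket x v w • u + bracket u x w • v + bracket u v x • w := by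
  ext i
  fin_cases i <;> simp [bracket_eq] <;> ring

/-- Vectors representing a typical configuration of six points: no three are linearly dependent
and no nonzero quadratic form vanishes on all of them. -/
def TypicalVec (v : Fin 6 → Fin 3 → ℝ) : Prop :=
  (∀ i j k, i ≠ j → i ≠ k → j ≠ k → bracket (v i) (v j) (v k) ≠ 0) ∧
    ∀ q : QuadraticForm ℝ (Fin 3 → ℝ), q ≠ 0 → ∃ i, q (v i) ≠ 0

/-- All maximal minors are positive. -/
def PosVec (v : Fin 6 → Fin 3 → ℝ) : Prop :=
  ∀ i j k, i < j → j < k → 0 < bracket (v i) (v j) (v k)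

theorem PosVec.bracket_ne_zero {v : Fin 6 → Fin 3 → ℝ} (hv : PosVec v) {i j k : Fin 6}
    (hij : i ≠ j) (hik : i ≠ k) (hjk : j ≠ k) : bracket (v i) (v j) (v k) ≠ 0 := by
  wlog h1 : i < j generalizing i j
  · have := this hij.symm hjk hik (lt_of_le_of_ne (not_lt.1 h1) hij.symm)
    rwa [bracket_swap_left, neg_ne_zero]
  rcases lt_or_gt_of_ne hjk with h2 | h2
  · exact (hv i j k h1 h2).ne'
  rcases lt_or_gt_of_ne hik with h3 | h3
  · rw [← neg_ne_zero, ← bracket_swap_right]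
    exact (hv i k j h3 h2).ne'
  · rw [← bracket_rotate, ← bracket_rotate]
    exact (hv k i j h3 h1).ne'

theorem PosVec.rotate {v : Fin 6 → Fin 3 → ℝ} (hv : PosVec v) : PosVec fun i => v (i + 1) := by
  have succ : ∀ i j k : Fin 6, i < j → j < k →
      (k + 1 = 0 ∧ 0 < i + 1 ∧ i + 1 < j + 1) ∨ (i + 1 < j + 1 ∧ j + 1 < k + 1) := by decide
  intro i j k hij hjk
  rcases succ i j k hij hjk with ⟨h, h1, h2⟩ | ⟨h1, h2⟩
  · simp only [h]
    rw [bracket_rotate]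
    exact hv _ _ _ h1 h2
  · exact hv _ _ _ h1 h2

/-- The bracket polynomial that vanishes when six points lie on a conic. -/
def conicBracket (v : Fin 6 → Fin 3 → ℝ) : ℝ :=
  bracket (v 0) (v 1) (v 2) * bracket (v 2) (v 3) (v 4) * bracket (v 0) (v 4) (v 5) *
      bracket (v 1) (v 3) (v 5) -
    bracket (v 1) (v 2) (v 3) * bracket (v 3) (v 4) (v 5) * bracket (v 0) (v 1) (v 5) *
      bracket (v 0) (v 2) (v 4)

theorem conicBracket_rotate (v : Fin 6 → Fin 3 → ℝ) :
    conicBracket (fun i => v (i + 1)) = -conicBracket v := by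
  change bracket (v 1) (v 2) (v 3) * bracket (v 3) (v 4) (v 5) * bracket (v 1) (v 5) (v 0) *
      bracket (v 2) (v 4) (v 0) -
    bracket (v 2) (v 3) (v 4) * bracket (v 4) (v 5) (v 0) * bracket (v 1) (v 2) (v 0) *
      bracket (v 1) (v 3) (v 5) = _
  rw [bracket_rotate (v 0), bracket_rotate (v 0), bracket_rotate (v 0), bracket_rotate (v 0),
    conicBracket]
  ring

theorem conicBracket_smul_mulVec (g : Matrix (Fin 3) (Fin 3) ℝ) (s : Fin 6 → ℝ)
    (v : Fin 6 → Fin 3 → ℝ) : conicBracket (fun i => s i • g *ᵥ v i) =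
      g.det ^ 4 * (∏ i, s i) ^ 2 * conicBracket v := by
  simp only [conicBracket, bracket_smul, bracket_mulVec, Fin.prod_univ_six]
  ring

theorem TypicalVec.smul_mulVec {v : Fin 6 → Fin 3 → ℝ} (hv : TypicalVec v)
    {g : Matrix (Fin 3) (Fin 3) ℝ} (hg : g.det ≠ 0) {s : Fin 6 → ℝ} (hs : ∀ i, s i ≠ 0) :
    TypicalVec fun i => s i • g *ᵥ v i := by
  refine ⟨fun i j k hij hik hjk => ?_, fun q hq => ?_⟩
  · rw [bracket_smul, bracket_mulVec]
    exact mul_ne_zero (mul_ne_zero (mul_ne_zero (hs i) (hs j)) (hs k))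
      (mul_ne_zero hg (hv.1 i j k hij hik hjk))
  · obtain ⟨i, hi⟩ := hv.2 (q.comp (Matrix.toLin' g)) fun h => hq <| by
      ext x
      have := congrArg (fun p : QuadraticForm ℝ (Fin 3 → ℝ) => p (g⁻¹ *ᵥ x)) h
      simpa [mulVec_mulVec, mul_nonsing_inv g (isUnit_iff_ne_zero.2 hg)] using this
    refine ⟨i, ?_⟩
    rw [QuadraticMap.map_smul]
    exact smul_ne_zero (mul_ne_zero (hs i) (hs i)) (by simpa using hi)

end Brackets

section NormalForm

open Matrix

/-- A quadratic form on `ℝ³` vanishing on the standard basis is a combination of the products of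
two distinct coordinates. -/
theorem QuadraticForm.apply_of_basis_eq_zero (q : QuadraticForm ℝ (Fin 3 → ℝ))
    (h0 : q ![1, 0, 0] = 0) (h1 : q ![0, 1, 0] = 0) (h2 : q ![0, 0, 1] = 0) (x : Fin 3 → ℝ) :
    q x = x 1 * x 2 * QuadraticMap.polar q ![0, 1, 0] ![0, 0, 1] +
      x 0 * x 2 * QuadraticMap.polar q ![1, 0, 0] ![0, 0, 1] +
      x 0 * x 1 * QuadraticMap.polar q ![1, 0, 0] ![0, 1, 0] := by
  have hx : x = x 0 • ![1, 0, 0] + x 1 • ![0, 1, 0] + x 2 • ![0, 0, 1] := by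
    ext i
    fin_cases i <;> simp
  conv_lhs => rw [hx]
  rw [QuadraticMap.map_add q, QuadraticMap.map_add q, QuadraticMap.polar_add_left]
  simp only [QuadraticMap.map_smul, QuadraticMap.polar_smul_left, QuadraticMap.polar_smul_right,
    h0, h1, h2, smul_eq_mul]
  ring

/-- Six vectors, three of which form the standard basis. Every sextuple of vectors with positive
maximal minors is of this shape up to a linear map and positive scalings. -/
def normalForm (x₁ y₁ y₃ z₃ x₅ z₅ : ℝ) : Fin 6 → Fin 3 → ℝ :=
  ![![1, 0, 0], ![x₁, y₁, -1], ![0, 1, 0], ![-1, y₃, z₃], ![0, 0, 1], ![x₅, -1, z₅]]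

theorem posVec_normalForm {x₁ y₁ y₃ z₃ x₅ z₅ : ℝ} (hx₁ : 0 < x₁) (hy₁ : 0 < y₁) (hy₃ : 0 < y₃)
    (hz₃ : 0 < z₃) (hx₅ : 0 < x₅) (hz₅ : 0 < z₅) (hA : 1 < x₁ * z₃) (hB : 1 < y₃ * x₅)
    (hC : 1 < y₁ * z₅) : PosVec (normalForm x₁ y₁ y₃ z₃ x₅ z₅) := by
  have h₁ := mul_pos hx₁ hy₃
  have h₂ := mul_pos hy₁ hz₃
  have h₃ := mul_pos hy₃ hz₅
  have h₄ := mul_pos hz₃ hx₅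
  have h₅ := mul_pos hx₁ hz₅
  have h₆ := mul_pos hy₁ hx₅
  have h₇ := mul_pos h₁ hz₅
  have h₈ := mul_pos h₂ hx₅
  intro i j k hij hjk
  rw [bracket_eq]
  fin_cases i <;> fin_cases j <;> first | exact absurd hij (by decide) | skip
  all_goals fin_cases k <;> first | exact absurd hjk (by decide) | skip
  all_goals simp [normalForm] <;> nlinarith

theorem conicBracket_normalForm (x₁ y₁ y₃ z₃ x₅ z₅ : ℝ) :
    conicBracket (normalForm x₁ y₁ y₃ z₃ x₅ z₅) =
      x₁ * y₃ * z₅ + y₁ * z₃ * x₅ + x₁ * z₃ * (y₃ * x₅) + y₃ * x₅ * (y₁ * z₅) +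
        x₁ * z₃ * (y₁ * z₅) - x₁ * z₃ * (y₃ * x₅) * (y₁ * z₅) := by
  simp [conicBracket, bracket_eq, normalForm]
  ring

/-- The values at the last three vectors of a normal form of the products of two distinct
coordinates. -/
def conicMatrix (x₁ y₁ y₃ z₃ x₅ z₅ : ℝ) : Matrix (Fin 3) (Fin 3) ℝ :=
  !![-y₁, -x₁, x₁ * y₁; y₃ * z₃, -z₃, -y₃; -z₅, x₅ * z₅, -x₅]

theorem det_conicMatrix (x₁ y₁ y₃ z₃ x₅ z₅ : ℝ) : (conicMatrix x₁ y₁ y₃ z₃ x₅ z₅).det =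
    -conicBracket (normalForm x₁ y₁ y₃ z₃ x₅ z₅) := by
  rw [conicBracket_normalForm, conicMatrix, det_fin_three]
  simp
  ring

theorem typicalVec_normalForm_iff {x₁ y₁ y₃ z₃ x₅ z₅ : ℝ}
    (hpos : PosVec (normalForm x₁ y₁ y₃ z₃ x₅ z₅)) :
    TypicalVec (normalForm x₁ y₁ y₃ z₃ x₅ z₅) ↔
      conicBracket (normalForm x₁ y₁ y₃ z₃ x₅ z₅) ≠ 0 := by
  constructor
  · intro h hD
    have hdet : (conicMatrix x₁ y₁ y₃ z₃ x₅ z₅).det = 0 := by rw [det_conicMatrix, hD, neg_zero]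
    obtain ⟨c, hc, hMc⟩ := exists_mulVec_eq_zero_iff.2 hdet
    let p (i : Fin 3) : (Fin 3 → ℝ) →ₗ[ℝ] ℝ := LinearMap.proj i
    let q : QuadraticForm ℝ (Fin 3 → ℝ) := c 0 • QuadraticMap.linMulLin (p 1) (p 2) +
      c 1 • QuadraticMap.linMulLin (p 0) (p 2) + c 2 • QuadraticMap.linMulLin (p 0) (p 1)
    have hq (x : Fin 3 → ℝ) :
        q x = c 0 * (x 1 * x 2) + c 1 * (x 0 * x 2) + c 2 * (x 0 * x 1) := by
      simp [q, p]
    obtain ⟨i, hi⟩ := h.2 q fun h0 => hc <| by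
      have hz (x : Fin 3 → ℝ) := (hq x).symm.trans (by rw [h0]; rfl : q x = 0)
      ext i
      fin_cases i
      · simpa using hz ![0, 1, 1]
      · simpa using hz ![1, 0, 1]
      · simpa using hz ![1, 1, 0]
    apply hi
    have e0 := congrFun hMc 0
    have e1 := congrFun hMc 1
    have e2 := congrFun hMc 2
    simp [conicMatrix, mulVec, dotProduct, Fin.sum_univ_three] at e0 e1 e2
    rw [hq]
    fin_cases i <;> simp [normalForm] <;> linarith
  · intro hD
    refine ⟨fun i j k => hpos.bracket_ne_zero, fun q hq => ?_⟩
    by_contra! hzero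
    have key := QuadraticForm.apply_of_basis_eq_zero q (hzero 0) (hzero 2) (hzero 4)
    set c : Fin 3 → ℝ := ![QuadraticMap.polar q ![0, 1, 0] ![0, 0, 1],
      QuadraticMap.polar q ![1, 0, 0] ![0, 0, 1], QuadraticMap.polar q ![1, 0, 0] ![0, 1, 0]] with hc
    have hdet : (conicMatrix x₁ y₁ y₃ z₃ x₅ z₅).det ≠ 0 := by
      rwa [det_conicMatrix, neg_ne_zero]
    have hc0 : c = 0 := by
      refine eq_zero_of_mulVec_eq_zero hdet ?_
      have e0 := (key _).symm.trans (hzero 1)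
      have e1 := (key _).symm.trans (hzero 3)
      have e2 := (key _).symm.trans (hzero 5)
      simp [normalForm] at e0 e1 e2
      ext i
      fin_cases i <;> simp [conicMatrix, mulVec, dotProduct, Fin.sum_univ_three, hc] <;> linarith
    refine hq (QuadraticMap.ext fun x => ?_)
    have c0 := congrFun hc0 0
    have c1 := congrFun hc0 1
    have c2 := congrFun hc0 2
    simp [hc] at c0 c1 c2
    rw [key, c0, c1, c2]
    simp

theorem PosVec.exists_normalForm {v : Fin 6 → Fin 3 → ℝ} (hv : PosVec v) :
    ∃ (g : Matrix (Fin 3) (Fin 3) ℝ) (s : Fin 6 → ℝ) (x₁ y₁ y₃ z₃ x₅ z₅ : ℝ),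
      0 < g.det ∧ (∀ i, 0 < s i) ∧ 0 < x₁ ∧ 0 < y₁ ∧ 0 < y₃ ∧ 0 < z₃ ∧ 0 < x₅ ∧ 0 < z₅ ∧
      v = fun i => s i • g *ᵥ normalForm x₁ y₁ y₃ z₃ x₅ z₅ i := by
  have h024 := hv 0 2 4 (by decide) (by decide)
  have h124 := hv 1 2 4 (by decide) (by decide)
  have h014 := hv 0 1 4 (by decide) (by decide)
  have h012 := hv 0 1 2 (by decide) (by decide)
  have h034 := hv 0 3 4 (by decide) (by decide)
  have h234 := hv 2 3 4 (by decide) (by decide)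
  have h023 := hv 0 2 3 (by decide) (by decide)
  have h245 := hv 2 4 5 (by decide) (by decide)
  have h045 := hv 0 4 5 (by decide) (by decide)
  have h025 := hv 0 2 5 (by decide) (by decide)
  have cramer (x : Fin 3 → ℝ) := bracket_smul_eq (v 0) (v 2) (v 4) x
  have hg (a b c : ℝ) : (Matrix.of ![v 0, v 2, v 4])ᵀ *ᵥ ![a, b, c] =
      a • v 0 + b • v 2 + c • v 4 := by
    ext i
    simp [mulVec, dotProduct, Fin.sum_univ_three]
    ring
  set d := bracket (v 0) (v 2) (v 4) with hd
  refine ⟨(Matrix.of ![v 0, v 2, v 4])ᵀ,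
    ![1, bracket (v 0) (v 1) (v 2) / d, 1, bracket (v 2) (v 3) (v 4) / d, 1,
      bracket (v 0) (v 4) (v 5) / d],
    bracket (v 1) (v 2) (v 4) / bracket (v 0) (v 1) (v 2),
    bracket (v 0) (v 1) (v 4) / bracket (v 0) (v 1) (v 2),
    bracket (v 0) (v 3) (v 4) / bracket (v 2) (v 3) (v 4),
    bracket (v 0) (v 2) (v 3) / bracket (v 2) (v 3) (v 4),
    bracket (v 2) (v 4) (v 5) / bracket (v 0) (v 4) (v 5),
    bracket (v 0) (v 2) (v 5) / bracket (v 0) (v 4) (v 5), ?_, ?_, by positivity, by positivity,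
    by positivity, by positivity, by positivity, by positivity, ?_⟩
  · rwa [det_transpose]
  · intro i
    fin_cases i <;> simp <;> positivity
  have smul_cancel {x y : Fin 3 → ℝ} (h : d • x = d • y) : x = y := smul_right_injective _ h024.ne' h
  funext i
  apply smul_cancel
  fin_cases i
  · simp [normalForm, hg]
  · change d • v 1 = d • _ • _ *ᵥ ![_, _, _]
    rw [cramer, hg, bracket_swap_right (v 0) (v 1) (v 2)]
    simp only [smul_add, smul_smul]
    congr 1
    · congr 1 <;> congr 1 <;> simp <;> field_simp
    · congr 1; simp; field_simp
  · simp [normalForm, hg]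
  · change d • v 3 = d • _ • _ *ᵥ ![_, _, _]
    rw [cramer, hg, bracket_swap_left (v 2) (v 3) (v 4)]
    simp only [smul_add, smul_smul]
    congr 1
    · congr 1 <;> congr 1 <;> simp <;> field_simp
    · congr 1; simp; field_simp
  · simp [normalForm, hg]
  · change d • v 5 = d • _ • _ *ᵥ ![_, _, _]
    rw [cramer, hg, bracket_swap_right (v 0) (v 4) (v 5), ← bracket_rotate (v 5) (v 2) (v 4)]
    simp only [smul_add, smul_smul]
    congr 1
    · congr 1 <;> congr 1 <;> simp <;> field_simp
    · congr 1; simp; field_simp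

end NormalForm

section Region

/-- A normal form parametrized so that positivity of its minors is a condition on each parameter
separately. -/
def paramForm (p : Fin 6 → ℝ) : Fin 6 → Fin 3 → ℝ :=
  normalForm (p 0) (p 5 / p 2) (p 1) (p 3 / p 0) (p 4 / p 1) (p 2)

theorem conicBracket_paramForm {p : Fin 6 → ℝ} (h0 : 0 < p 0) (h1 : 0 < p 1) (h2 : 0 < p 2) :
    conicBracket (paramForm p) = p 0 * p 1 * p 2 + p 3 * p 4 * p 5 / (p 0 * p 1 * p 2) +
      p 3 * p 4 + p 4 * p 5 + p 3 * p 5 - p 3 * p 4 * p 5 := by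
  rw [paramForm, conicBracket_normalForm]
  field_simp

/-- The parameters of the normal forms with positive minors and positive conic bracket. -/
def paramRegion : Set (Fin 6 → ℝ) :=
  {p | 0 < p 0 ∧ 0 < p 1 ∧ 0 < p 2 ∧ 1 < p 3 ∧ 1 < p 4 ∧ 1 < p 5 ∧ 0 < conicBracket (paramForm p)}

theorem typicalVec_paramForm {p : Fin 6 → ℝ} (hp : p ∈ paramRegion) :
    TypicalVec (paramForm p) := by
  obtain ⟨h0, h1, h2, h3, h4, h5, hD⟩ := hp
  refine (typicalVec_normalForm_iff (posVec_normalForm h0 ?_ h1 ?_ ?_ h2 ?_ ?_ ?_)).2 hD.ne'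
  · positivity
  · positivity
  · positivity
  · rwa [mul_div_cancel₀ _ h0.ne']
  · rwa [mul_div_cancel₀ _ h1.ne']
  · rwa [div_mul_cancel₀ _ h2.ne']

theorem continuousOn_paramForm : ContinuousOn paramForm paramRegion := by
  have h0 : ∀ p ∈ paramRegion, p 0 ≠ 0 := fun p hp => hp.1.ne'
  have h1 : ∀ p ∈ paramRegion, p 1 ≠ 0 := fun p hp => hp.2.1.ne'
  have h2 : ∀ p ∈ paramRegion, p 2 ≠ 0 := fun p hp => hp.2.2.1.ne'
  refine continuousOn_pi.2 fun i => continuousOn_pi.2 fun j => ?_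
  fin_cases i <;> fin_cases j <;> simp [paramForm, normalForm] <;> fun_prop (disch := assumption)

/-- Shrinking the last three parameters while keeping them greater than one stays in the region. -/
theorem mem_paramRegion_of_le {p q : Fin 6 → ℝ} (hp : p ∈ paramRegion) (hqp : q ≤ p)
    (h0 : q 0 = p 0) (h1 : q 1 = p 1) (h2 : q 2 = p 2) (h3 : 1 < q 3) (h4 : 1 < q 4)
    (h5 : 1 < q 5) : q ∈ paramRegion := by
  obtain ⟨p0, p1, p2, p3, p4, p5, hD⟩ := hp
  have q0 := h0 ▸ p0
  have q1 := h1 ▸ p1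
  have q2 := h2 ▸ p2
  refine ⟨q0, q1, q2, h3, h4, h5, ?_⟩
  have factor {r : Fin 6 → ℝ} (r0 : 0 < r 0) (r1 : 0 < r 1) (r2 : 0 < r 2) (r3 : 1 < r 3)
      (r4 : 1 < r 4) (r5 : 1 < r 5) : 0 < conicBracket (paramForm r) ↔
      1 < (r 3)⁻¹ + (r 4)⁻¹ + (r 5)⁻¹ + (r 0 * r 1 * r 2)⁻¹ +
        r 0 * r 1 * r 2 * ((r 3)⁻¹ * (r 4)⁻¹ * (r 5)⁻¹) := by
    have e : conicBracket (paramForm r) = r 3 * r 4 * r 5 *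
        ((r 3)⁻¹ + (r 4)⁻¹ + (r 5)⁻¹ + (r 0 * r 1 * r 2)⁻¹ +
          r 0 * r 1 * r 2 * ((r 3)⁻¹ * (r 4)⁻¹ * (r 5)⁻¹) - 1) := by
      rw [conicBracket_paramForm r0 r1 r2]
      field_simp
      ring
    rw [e, mul_pos_iff_of_pos_left (by positivity), sub_pos]
  rw [factor q0 q1 q2 h3 h4 h5, h0, h1, h2]
  refine ((factor p0 p1 p2 p3 p4 p5).1 hD).trans_le ?_
  have := hqp 3
  have := hqp 4
  have := hqp 5
  gcongr

/-- The region of parameters is path connected: first shrink the last three parameters, then move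
inside a box. -/
theorem joinedIn_paramRegion {p : Fin 6 → ℝ} (hp : p ∈ paramRegion) :
    JoinedIn paramRegion p ![1, 1, 1, 2, 2, 2] := by
  have ⟨p0, p1, p2, p3, p4, p5, _⟩ := hp
  set p' : Fin 6 → ℝ := ![p 0, p 1, p 2, min (p 3) 2, min (p 4) 2, min (p 5) 2] with hp'
  have hle : p' ≤ p := by
    intro i
    fin_cases i <;> simp [hp']
  have hbox : Set.pi Set.univ ![Set.Ioi 0, Set.Ioi 0, Set.Ioi 0, Set.Ioc 1 2, Set.Ioc 1 2,
      Set.Ioc (1 : ℝ) 2] ⊆ paramRegion := by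
    intro r hr
    have r0 : 0 < r 0 := hr 0 trivial
    have r1 : 0 < r 1 := hr 1 trivial
    have r2 : 0 < r 2 := hr 2 trivial
    have ⟨r3, r3'⟩ : 1 < r 3 ∧ r 3 ≤ 2 := hr 3 trivial
    have ⟨r4, r4'⟩ : 1 < r 4 ∧ r 4 ≤ 2 := hr 4 trivial
    have ⟨r5, r5'⟩ : 1 < r 5 ∧ r 5 ≤ 2 := hr 5 trivial
    refine ⟨r0, r1, r2, r3, r4, r5, ?_⟩
    rw [conicBracket_paramForm r0 r1 r2]
    have s3 : 0 < r 3 := by linarith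
    have s4 : 0 < r 4 := by linarith
    have s5 : 0 < r 5 := by linarith
    have := mul_nonneg (mul_pos s4 s5).le (sub_nonneg.2 r3')
    have := mul_nonneg (mul_pos s3 s5).le (sub_nonneg.2 r4')
    have := mul_nonneg (mul_pos s3 s4).le (sub_nonneg.2 r5')
    have : 0 < r 0 * r 1 * r 2 := by positivity
    have : 0 < r 3 * r 4 * r 5 / (r 0 * r 1 * r 2) := by positivity
    nlinarith [mul_pos s3 s4, mul_pos s4 s5, mul_pos s3 s5]
  have hshrink : JoinedIn paramRegion p p' := by
    refine JoinedIn.of_segment_subset (((convex_Icc p' p).segment_subset ⟨hle, le_rfl⟩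
      ⟨le_rfl, hle⟩).trans fun q hq => ?_)
    have l3 : min (p 3) 2 ≤ q 3 := hq.1 3
    have l4 : min (p 4) 2 ≤ q 4 := hq.1 4
    have l5 : min (p 5) 2 ≤ q 5 := hq.1 5
    exact mem_paramRegion_of_le hp hq.2 (le_antisymm (hq.2 0) (hq.1 0))
      (le_antisymm (hq.2 1) (hq.1 1)) (le_antisymm (hq.2 2) (hq.1 2))
      ((lt_min p3 one_lt_two).trans_le l3) ((lt_min p4 one_lt_two).trans_le l4)
      ((lt_min p5 one_lt_two).trans_le l5)
  refine hshrink.trans (JoinedIn.of_segment_subset (Set.Subset.trans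
    (Convex.segment_subset (convex_pi fun i _ => ?_) ?_ ?_) hbox))
  · fin_cases i
    · exact convex_Ioi 0
    · exact convex_Ioi 0
    · exact convex_Ioi 0
    · exact convex_Ioc 1 2
    · exact convex_Ioc 1 2
    · exact convex_Ioc 1 2
  · intro i _
    fin_cases i <;> simp [*]
  · intro i _
    fin_cases i <;> simp

end Region

section Connecting

open Matrix

theorem PosVec.of_smul_mulVec {v : Fin 6 → Fin 3 → ℝ} {g : Matrix (Fin 3) (Fin 3) ℝ}
    {s : Fin 6 → ℝ} (hg : 0 < g.det) (hs : ∀ i, 0 < s i)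
    (h : PosVec fun i => s i • g *ᵥ v i) : PosVec v := by
  intro i j k hij hjk
  have := h i j k hij hjk
  rw [bracket_smul, bracket_mulVec] at this
  exact pos_of_mul_pos_right (pos_of_mul_pos_right this
    (mul_pos (mul_pos (hs i) (hs j)) (hs k)).le) hg.le

theorem TypicalVec.of_smul_mulVec {v : Fin 6 → Fin 3 → ℝ} {g : Matrix (Fin 3) (Fin 3) ℝ}
    {s : Fin 6 → ℝ} (hg : g.det ≠ 0) (hs : ∀ i, s i ≠ 0)
    (h : TypicalVec fun i => s i • g *ᵥ v i) : TypicalVec v := by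
  have hu : IsUnit g.det := isUnit_iff_ne_zero.2 hg
  have := h.smul_mulVec (g := g⁻¹) (s := fun i => (s i)⁻¹)
    (((isUnit_nonsing_inv_det_iff).2 hu).ne_zero) fun i => inv_ne_zero (hs i)
  simpa [mulVec_smul, smul_smul, hs, mulVec_mulVec, nonsing_inv_mul g hu] using this

theorem PosVec.conicBracket_ne_zero {v : Fin 6 → Fin 3 → ℝ} (hv : PosVec v)
    (ht : TypicalVec v) : conicBracket v ≠ 0 := by
  obtain ⟨g, s, x₁, y₁, y₃, z₃, x₅, z₅, hg, hs, -, -, -, -, -, -, rfl⟩ := hv.exists_normalForm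
  rw [conicBracket_smul_mulVec]
  have hprod : ∏ i, s i ≠ 0 := Finset.prod_ne_zero_iff.2 fun i _ => (hs i).ne'
  exact mul_ne_zero (mul_ne_zero (pow_ne_zero _ hg.ne') (pow_ne_zero _ hprod))
    ((typicalVec_normalForm_iff (hv.of_smul_mulVec hg hs)).1
      (ht.of_smul_mulVec hg.ne' fun i => (hs i).ne'))

/-- The hexagon to which all the others are deformed. -/
def baseVec : Fin 6 → Fin 3 → ℝ := paramForm ![1, 1, 1, 2, 2, 2]

theorem PosVec.joinedIn_baseVec {v : Fin 6 → Fin 3 → ℝ} (hv : PosVec v)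
    (hD : 0 < conicBracket v) :
    JoinedIn {w | TypicalVec w} v baseVec ∨ JoinedIn {w | TypicalVec w} v (-baseVec) := by
  obtain ⟨g, s, x₁, y₁, y₃, z₃, x₅, z₅, hg, hs, hx₁, hy₁, hy₃, hz₃, hx₅, hz₅, rfl⟩ :=
    hv.exists_normalForm
  have hpos := hv.of_smul_mulVec hg hs
  have hpar : normalForm x₁ y₁ y₃ z₃ x₅ z₅ =
      paramForm ![x₁, y₃, z₅, x₁ * z₃, y₃ * x₅, y₁ * z₅] := by
    have e₁ : y₁ * z₅ / z₅ = y₁ := by field_simp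
    have e₂ : x₁ * z₃ / x₁ = z₃ := by field_simp
    have e₃ : y₃ * x₅ / y₃ = x₅ := by field_simp
    simp [paramForm, e₁, e₂, e₃]
  rw [conicBracket_smul_mulVec] at hD
  have hD' := pos_of_mul_pos_right hD (by positivity)
  have hmem : ![x₁, y₃, z₅, x₁ * z₃, y₃ * x₅, y₁ * z₅] ∈ paramRegion := by
    have hA := hpos 1 2 3 (by decide) (by decide)
    have hB := hpos 3 4 5 (by decide) (by decide)
    have hC := hpos 0 1 5 (by decide) (by decide)
    simp [bracket_eq, normalForm] at hA hB hC
    refine ⟨hx₁, hy₃, hz₅, ?_, ?_, ?_, hpar ▸ hD'⟩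
    · simpa using (by linarith : 1 < x₁ * z₃)
    · simpa using (by linarith : 1 < y₃ * x₅)
    · simpa using (by linarith : 1 < y₁ * z₅)
  have hone : ∀ i : Fin 6, (1 : ℝ) ≠ 0 := fun _ => one_ne_zero
  have hnf := typicalVec_paramForm hmem
  rw [← hpar] at hnf
  have hscale : JoinedIn {w | TypicalVec w}
      (fun i => s i • g *ᵥ normalForm x₁ y₁ y₃ z₃ x₅ z₅ i)
      (fun i => (1 : ℝ) • g *ᵥ normalForm x₁ y₁ y₃ z₃ x₅ z₅ i) := by
    refine JoinedIn.ofLine (f := fun t i => ((1 - t) * s i + t) •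
      g *ᵥ normalForm x₁ y₁ y₃ z₃ x₅ z₅ i) ?_ ?_ ?_ ?_
    · exact Continuous.continuousOn (continuous_pi fun i => by fun_prop)
    · simp
    · simp
    · rintro _ ⟨t, ht, rfl⟩
      refine hnf.smul_mulVec hg.ne' fun i => ?_
      rcases ht.1.eq_or_lt with rfl | h0
      · simpa using (hs i).ne'
      · have := mul_nonneg (sub_nonneg.2 ht.2) (hs i).le
        positivity
  have hparam : JoinedIn {w | TypicalVec w}
      (fun i => (1 : ℝ) • g *ᵥ normalForm x₁ y₁ y₃ z₃ x₅ z₅ i)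
      (fun i => (1 : ℝ) • g *ᵥ baseVec i) := by
    rw [hpar]
    have hcont : Continuous fun (w : Fin 6 → Fin 3 → ℝ) (i : Fin 6) => (1 : ℝ) • g *ᵥ w i :=
      continuous_pi fun i => by fun_prop
    refine (((joinedIn_paramRegion hmem).map_continuousOn continuousOn_paramForm).map hcont).mono ?_
    rintro _ ⟨_, ⟨q, hq, rfl⟩, rfl⟩
    exact (typicalVec_paramForm hq).smul_mulVec hg.ne' hone
  have hbase : TypicalVec baseVec := typicalVec_paramForm (joinedIn_paramRegion hmem).target_mem
  have hmatrix (N : Matrix (Fin 3) (Fin 3) ℝ)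
      (hN : JoinedIn {N : Matrix (Fin 3) (Fin 3) ℝ | N.det ≠ 0} g N) :
      JoinedIn {w | TypicalVec w} (fun i => (1 : ℝ) • g *ᵥ baseVec i)
        (fun i => (1 : ℝ) • N *ᵥ baseVec i) := by
    have hcont : Continuous fun (N : Matrix (Fin 3) (Fin 3) ℝ) (i : Fin 6) =>
        (1 : ℝ) • N *ᵥ baseVec i := continuous_pi fun i => by fun_prop
    refine (hN.map hcont).mono ?_
    rintro _ ⟨N, hN, rfl⟩
    exact hbase.smul_mulVec hN hone
  refine (joinedIn_one_or_neg_one_of_det_ne_zero g hg.ne').imp (fun h => ?_) (fun h => ?_)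
  · convert (hscale.trans hparam).trans (hmatrix _ h) using 1
    ext i
    simp
  · convert (hscale.trans hparam).trans (hmatrix _ h) using 1
    ext i
    simp [neg_mulVec]

end Connecting

section ConvexPosition

/-- A vertex of a convex polygon is not in a triangle spanned by three other vertices. -/
theorem not_mem_triangle {n : ℕ} {c : Fin n → Fin 3 → ℝ} {φ : (Fin 3 → ℝ) →ₗ[ℝ] ℝ}
    (hφ : ∀ i, φ (c i) = 1) {l : Fin n} (hl : c l ∉ convexHull ℝ (c '' {j | j ≠ l}))
    {i j k : Fin n} (hi : i ≠ l) (hj : j ≠ l) (hk : k ≠ l)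
    (h₁ : 0 < bracket (c l) (c j) (c k)) (h₂ : 0 < bracket (c i) (c l) (c k))
    (h₃ : 0 < bracket (c i) (c j) (c l)) : False := by
  have cramer := bracket_smul_eq (c i) (c j) (c k) (c l)
  have sum := congrArg φ cramer
  simp only [map_add, map_smul, hφ, smul_eq_mul, mul_one] at sum
  have hd : 0 < bracket (c i) (c j) (c k) := by linarith
  refine hl ?_
  have hconv := convex_convexHull ℝ (c '' {j | j ≠ l})
  have mem {m : Fin n} (hm : m ≠ l) : c m ∈ convexHull ℝ (c '' {j | j ≠ l}) :=
    subset_convexHull ℝ _ ⟨m, hm, rfl⟩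
  have key := hconv.sum_mem (t := Finset.univ)
    (w := ![bracket (c l) (c j) (c k) / bracket (c i) (c j) (c k),
      bracket (c i) (c l) (c k) / bracket (c i) (c j) (c k),
      bracket (c i) (c j) (c l) / bracket (c i) (c j) (c k)]) (z := ![c i, c j, c k])
    (by intro m _; fin_cases m <;> simp <;> positivity)
    (by simp [Fin.sum_univ_three]; field_simp; linarith)
    (by intro m _; fin_cases m <;> simp [mem, hi, hj, hk])
  convert key using 1
  refine smul_right_injective _ hd.ne' ?_
  simp only [cramer, Fin.sum_univ_three, Matrix.cons_val, smul_add, smul_smul,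
    mul_div_cancel₀ _ hd.ne']

theorem exists_equiv_fin_of_isStrictTotalOrder {α : Type*} [Fintype α] {n : ℕ} (r : α → α → Prop)
    [IsStrictTotalOrder α r] (h : Fintype.card α = n) :
    ∃ e : Fin n ≃ α, ∀ i j, i < j → r (e i) (e j) := by
  classical
  let _ := linearOrderOfSTO r
  exact ⟨(monoEquivOfFin α h).toEquiv, fun i j hij => (monoEquivOfFin α h).strictMono hij⟩

/-- The vertices of a convex polygon can be sorted by their direction seen from one of them. -/
theorem exists_perm_posVec {c : Fin 6 → Fin 3 → ℝ} {φ : (Fin 3 → ℝ) →ₗ[ℝ] ℝ}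
    (hφ : ∀ i, φ (c i) = 1) (hc : ∀ i, c i ∉ convexHull ℝ (c '' {j | j ≠ i}))
    (hne : ∀ i j k, i ≠ j → i ≠ k → j ≠ k → bracket (c i) (c j) (c k) ≠ 0) :
    ∃ σ : Equiv.Perm (Fin 6), PosVec fun i => c (σ i) := by
  classical
  have irr (u w : Fin 3 → ℝ) : bracket u w w = 0 := by
    have := bracket_swap_right u w w
    linarith
  let r (i j : Fin 6) : Prop := j ≠ 0 ∧ (i = 0 ∨ 0 < bracket (c 0) (c i) (c j))
  have : IsStrictTotalOrder (Fin 6) r :=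
    { trichotomous := by
        intro i j hij hji
        by_contra hne'
        by_cases hi : i = 0
        · exact hij ⟨fun hj => hne' (hi.trans hj.symm), Or.inl hi⟩
        by_cases hj : j = 0
        · exact hji ⟨hi, Or.inl hj⟩
        rcases lt_or_gt_of_ne (hne 0 i j (Ne.symm hi) (Ne.symm hj) hne') with h | h
        · exact hji ⟨hi, Or.inr (by rw [bracket_swap_right]; linarith)⟩
        · exact hij ⟨hj, Or.inr h⟩
      irrefl := by
        rintro i ⟨hi, h | h⟩
        · exact hi h
        · rw [irr] at h
          exact h.false
      trans := by
        rintro i j k ⟨hj, hij⟩ ⟨hk, hjk⟩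
        refine ⟨hk, ?_⟩
        by_cases hi : i = 0
        · exact Or.inl hi
        have hij := hij.resolve_left hi
        have hjk := hjk.resolve_left hj
        refine Or.inr (not_le.1 fun hle => ?_)
        have hik : i ≠ k := by
          rintro rfl
          rw [bracket_swap_right] at hjk
          linarith
        have hki : 0 < bracket (c 0) (c k) (c i) := by
          rw [bracket_swap_right]
          exact neg_pos.2 (lt_of_le_of_ne hle (hne 0 i k (Ne.symm hi) (Ne.symm hk) hik))
        refine not_mem_triangle hφ (hc 0) hi hj hk hjk ?_ ?_
        · rwa [bracket_rotate] at hki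
        · rwa [← bracket_rotate (c 0)] at hij }
  obtain ⟨e, he⟩ := exists_equiv_fin_of_isStrictTotalOrder r (Fintype.card_fin 6)
  refine ⟨e, fun i j k hij hjk => ?_⟩
  have ⟨hj, hij'⟩ := he i j hij
  have ⟨_, hjk'⟩ := he j k hjk
  have hjk' := hjk'.resolve_left hj
  by_cases hi : e i = 0
  · simpa only [hi] using hjk'
  have hij' := hij'.resolve_left hi
  refine not_le.1 fun hle => ?_
  have hneg : 0 < bracket (c (e j)) (c (e i)) (c (e k)) := by
    rw [bracket_swap_left]
    exact neg_pos.2 (lt_of_le_of_ne hle (hne _ _ _ (e.injective.ne hij.ne)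
      (e.injective.ne (hij.trans hjk).ne) (e.injective.ne hjk.ne)))
  exact not_mem_triangle hφ (hc (e j)) hj.symm (e.injective.ne hij.ne) (e.injective.ne hjk.ne')
    hneg hjk' hij'

end ConvexPosition

section Projective

/-- The configuration of the lines spanned by nonzero vectors. -/
def toConfig {n : ℕ} (v : Fin n → Fin 3 → ℝ) (hv : ∀ i, v i ≠ 0) : Fin n → RP2 :=
  fun i => Projectivization.mk ℝ (v i) (hv i)

theorem exists_rep_toConfig {n : ℕ} (v : Fin n → Fin 3 → ℝ) (hv : ∀ i, v i ≠ 0) (i : Fin n) :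
    ∃ a : ℝ, a ≠ 0 ∧ (toConfig v hv i).rep = a • v i := by
  obtain ⟨a, ha⟩ := Projectivization.exists_smul_eq_mk_rep ℝ (v i) (hv i)
  exact ⟨a, a.ne_zero, ha.symm⟩

theorem toConfig_smul {n : ℕ} (v : Fin n → Fin 3 → ℝ) (hv : ∀ i, v i ≠ 0) (a : Fin n → ℝ)
    (hav : ∀ i, a i • v i ≠ 0) : toConfig (fun i => a i • v i) hav = toConfig v hv :=
  funext fun i => (Projectivization.mk_eq_mk_iff' ℝ _ _ _ _).2 ⟨a i, rfl⟩

theorem toConfig_congr {n : ℕ} {v w : Fin n → Fin 3 → ℝ} (h : v = w) (hv : ∀ i, v i ≠ 0)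
    (hw : ∀ i, w i ≠ 0) : toConfig v hv = toConfig w hw := by
  subst h
  rfl

theorem toConfig_rep {n : ℕ} (f : Fin n → RP2) :
    toConfig (fun i => (f i).rep) (fun i => (f i).rep_nonzero) = f :=
  funext fun i => Projectivization.mk_rep (f i)

theorem TypicalVec.smul {v : Fin 6 → Fin 3 → ℝ} (hv : TypicalVec v) {a : Fin 6 → ℝ}
    (ha : ∀ i, a i ≠ 0) : TypicalVec fun i => a i • v i := by
  simpa using hv.smul_mulVec (g := 1) (by simp) ha

theorem TypicalVec.comp_perm {v : Fin 6 → Fin 3 → ℝ} (hv : TypicalVec v)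
    (σ : Equiv.Perm (Fin 6)) : TypicalVec fun i => v (σ i) := by
  refine ⟨fun i j k hij hik hjk => hv.1 _ _ _ (σ.injective.ne hij) (σ.injective.ne hik)
    (σ.injective.ne hjk), fun q hq => ?_⟩
  obtain ⟨i, hi⟩ := hv.2 q hq
  exact ⟨σ.symm i, by simpa using hi⟩

theorem TypicalVec.ne_zero {v : Fin 6 → Fin 3 → ℝ} (hv : TypicalVec v) (i : Fin 6) : v i ≠ 0 := by
  intro h
  have distinct : ∀ j : Fin 6, j ≠ j + 1 ∧ j ≠ j + 2 ∧ j + 1 ≠ j + 2 := by decide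
  obtain ⟨h₁, h₂, h₃⟩ := distinct i
  exact hv.1 i (i + 1) (i + 2) h₁ h₂ h₃ (by simp [bracket_eq, h])

theorem typicalCfg_iff (f : Fin 6 → RP2) : TypicalCfg f ↔ TypicalVec fun i => (f i).rep := by
  constructor
  · rintro ⟨⟨-, h⟩, hq⟩
    refine ⟨fun i j k hij hik hjk => ?_, fun q hq0 => ?_⟩
    · exact (linearIndependent_iff_bracket_ne_zero _ _ _).1 (not_not.1 (h i j k hij hik hjk))
    · by_contra! hzero
      exact hq id Function.injective_id ⟨q, hq0, by rintro _ ⟨i, rfl⟩; exact hzero i⟩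
  · intro h
    refine ⟨⟨fun i j hij => ?_, fun i j k hij hik hjk => not_not.2 ?_⟩, fun g hg => ?_⟩
    · by_contra hne
      obtain ⟨k, hik, hjk⟩ : ∃ k : Fin 6, i ≠ k ∧ j ≠ k := by
        clear hij hne
        revert i j
        decide
      refine h.1 i j k hne hik hjk ?_
      simp only [hij, bracket_eq]
      ring
    · exact (linearIndependent_iff_bracket_ne_zero _ _ _).2 (h.1 i j k hij hik hjk)
    · rintro ⟨q, hq, hzero⟩
      obtain ⟨i, hi⟩ := h.2 q hq
      obtain ⟨j, rfl⟩ := Finite.surjective_of_injective hg i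
      exact hi (hzero _ ⟨j, rfl⟩)

theorem TypicalVec.typicalCfg {v : Fin 6 → Fin 3 → ℝ} (h : TypicalVec v) (hv : ∀ i, v i ≠ 0) :
    TypicalCfg (toConfig v hv) := by
  choose a ha hav using exists_rep_toConfig v hv
  rw [typicalCfg_iff]
  simpa only [hav] using h.smul ha

theorem joinedIn_toConfig {v w : Fin 6 → Fin 3 → ℝ} (h : JoinedIn {u | TypicalVec u} v w)
    (hv : ∀ i, v i ≠ 0) (hw : ∀ i, w i ≠ 0) :
    JoinedIn {f : Fin 6 → RP2 | TypicalCfg f} (toConfig v hv) (toConfig w hw) := by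
  obtain ⟨γ, hγ⟩ := h
  refine ⟨⟨⟨fun t => toConfig (γ t) (hγ t).ne_zero, ?_⟩, ?_, ?_⟩, fun t => ?_⟩
  · exact continuous_pi fun i => continuous_quotient_mk'.comp
      (((continuous_apply i).comp γ.continuous).subtype_mk fun t => (hγ t).ne_zero i)
  · exact toConfig_congr γ.source _ hv
  · exact toConfig_congr γ.target _ hw
  · exact TypicalVec.typicalCfg (hγ t) _

theorem exists_perm_joinedIn {f : Fin 6 → RP2} (hf : TypicalCfg f) (hc : ConvexPos f)
    (hbase : ∀ i, baseVec i ≠ 0) :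
    ∃ σ : Equiv.Perm (Fin 6),
      JoinedIn {f : Fin 6 → RP2 | TypicalCfg f} (f ∘ σ) (toConfig baseVec hbase) := by
  obtain ⟨φ, -, hφ, hc⟩ := hc
  have hv : TypicalVec fun i => chart φ (f i) :=
    ((typicalCfg_iff f).1 hf).smul fun i => inv_ne_zero (hφ i)
  have hchart (i : Fin 6) : φ (chart φ (f i)) = 1 := by simp [chart, hφ i]
  obtain ⟨σ, hσ⟩ := exists_perm_posVec hchart (fun i => by simpa [Set.image_image] using hc i) hv.1
  obtain ⟨σ, hσ, hD⟩ : ∃ σ : Equiv.Perm (Fin 6), (PosVec fun i => chart φ (f (σ i))) ∧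
      0 < conicBracket fun i => chart φ (f (σ i)) := by
    rcases lt_or_gt_of_ne (hσ.conicBracket_ne_zero (hv.comp_perm σ)) with h | h
    · refine ⟨(Equiv.addRight 1).trans σ, hσ.rotate, ?_⟩
      have := conicBracket_rotate fun i => chart φ (f (σ i))
      simp only [Equiv.trans_apply, Equiv.coe_addRight]
      linarith
    · exact ⟨σ, hσ, h⟩
  refine ⟨σ, ?_⟩
  have hne := (hv.comp_perm σ).ne_zero
  have hsource : toConfig (fun i => chart φ (f (σ i))) hne = f ∘ σ :=
    (toConfig_smul _ (fun i => (f (σ i)).rep_nonzero) _ hne).trans (toConfig_rep (f ∘ σ))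
  have hneg : ∀ i, (-1 : ℝ) • baseVec i ≠ 0 := fun i => smul_ne_zero (by norm_num) (hbase i)
  have htarget := toConfig_smul baseVec hbase (fun _ => -1) hneg
  rw [← hsource]
  rcases hσ.joinedIn_baseVec hD with h | h
  · exact joinedIn_toConfig h hne hbase
  · rw [← htarget]
    refine joinedIn_toConfig ?_ hne hneg
    convert h using 1
    ext i
    simp

end Projective

/-- Any two hexagonal typical 6-configurations can be joined by a Q-deformation: the
hexagonal typical 6-configurations form a single Q-deformation class. -/
theorem hexagonal_single_qdeformation_class
    (f g : Fin 6 → RP2) (hf : TypicalCfg f) (hg : TypicalCfg g)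
    (hfc : ConvexPos f) (hgc : ConvexPos g) :
    ∃ γ : Fin 6 → unitInterval → RP2, QDeformFam 6 γ ∧
      (Set.range fun i => γ i 0) = Set.range f ∧
      (Set.range fun i => γ i 1) = Set.range g := by
  have hbase : ∀ i, baseVec i ≠ 0 := by
    intro i
    fin_cases i <;> simp [baseVec, paramForm, normalForm]
  obtain ⟨σ, hσ⟩ := exists_perm_joinedIn hf hfc hbase
  obtain ⟨τ, hτ⟩ := exists_perm_joinedIn hg hgc hbase
  obtain ⟨γ, hγ⟩ := hσ.trans hτ.symm
  refine ⟨fun i t => γ t i, ⟨fun i => (continuous_apply i).comp γ.continuous, hγ⟩, ?_, ?_⟩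
  · simp only [γ.source]
    exact σ.surjective.range_comp f
  · simp only [γ.target]
    exact τ.surjective.range_comp g

end
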